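/- Let (𝒜, ν) be a measure space of actions with expert density p_data (∫ p_data dν = 1), and let (Z, μ) be a σ-finite latent measure space with prior density π, jointly measurable likelihood ℓ(a, z) ≥ 0, and everywhere-positive posterior densities q(·|a) with ∫ q(·|a) dμ = 1. Let S ⊆ Z be measurable and d ∈ (0,1) with π(S) = 1 − d and q(S|a) = 1 − d for ν-a.e. a. With w(z,a) = ℓ(a,z)π(z)/q(z|a), W_T(a) = (1/q(T|a)) ∫_T w(z,a) q(z|a) dμ(z) for T ∈ {S, Sᶜ}, define the resampled partition masses q̃(S|a) = q(S|a) W_S(a) / ∫_Z w(z,a) q(z|a) dμ(z) and q̃(Sᶜ|a) = q(Sᶜ|a) W_{Sᶜ}(a) / ∫_Z w(z,a) q(z|a) dμ(z), and the conditional action likelihoods p(a|S) = (1/(1−d)) ∫_S ℓ(a,z)π(z) dμ and p(a|Sᶜ) = (1/d) ∫_{Sᶜ} ℓ(a,z)π(z) dμ, assumed strictly positive p_data-a.e. with both D_KL(p_data ‖ p(·|S)) and D_KL(p_data ‖ p(·|Sᶜ)) finite. Then the refined preference for the strategy S decomposes as its information benefit plus the warmstart preference: ∫_𝒜 p_data(a)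 · log(q̃(S|a) / q̃(Sᶜ|a)) dν(a) = [D_KL(p_data ‖ p(·|Sᶜ)) − D_KL(p_data ‖ p(·|S))] + log((1 − d)/d). -/

import Mathlib

open MeasureTheory

/-- **Refined preference = information benefit + warmstart preference.**
Let `(𝒜, ν)` be a measure space of actions with expert density `pdata`
(`∫ pdata dν = 1`), and `(Z, μ)` a σ-finite latent space with prior density
`π`, jointly measurable nonnegative likelihood `ℓ a z`, and
everywhere-positive posterior densities `q a` with `∫ q a dμ = 1`.  Let
`S ⊆ Z` be measurable and `d ∈ (0,1)` with `π(S) = 1 − d` and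
`q(S|a) = 1 − d` for ν-a.e. `a`.  With `w z a = ℓ a z * π z / q a z`,
conditional expected weights `W_T(a) = (1/q(T|a)) ∫_T w q dμ`, resampled
partition masses `q̃(T|a) = q(T|a) W_T(a) / ∫_Z w q dμ`, conditional action
likelihoods `p(a|S) = (1/(1−d)) ∫_S ℓ a z * π z dμ`,
`p(a|Sᶜ) = (1/d) ∫_{Sᶜ} ℓ a z * π z dμ` (strictly positive `pdata`-a.e.)
and both KL divergences finite, the refined preference decomposes as the
information benefit plus the warmstart preference:
`∫ pdata(a) log(q̃(S|a)/q̃(Sᶜ|a)) dν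
  = [D_KL(pdata ‖ p(·|Sᶜ)) − D_KL(pdata ‖ p(·|S))] + log((1−d)/d)`. -/
theorem refined_preference_decomposition
    {A : Type*} [MeasurableSpace A] (ν : Measure A)
    {Z : Type*} [MeasurableSpace Z] (μ : Measure Z) [SigmaFinite μ]
    (pdata : A → ℝ)
    (hpdata_meas : Measurable pdata) (hpdata_nonneg : ∀ a, 0 ≤ pdata a)
    (hpdata_int : ∫ a, pdata a ∂ν = 1)
    (π : Z → ℝ)
    (hπ_meas : Measurable π) (hπ_nonneg : ∀ z, 0 ≤ π z)
    (hπ_int : ∫ z, π z ∂μ = 1)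
    (ℓ : A → Z → ℝ)
    (hℓ_meas : Measurable (Function.uncurry ℓ)) (hℓ_nonneg : ∀ a z, 0 ≤ ℓ a z)
    (q : A → Z → ℝ)
    (hq_meas : Measurable (Function.uncurry q)) (hq_pos : ∀ a z, 0 < q a z)
    (hq_int : ∀ a, ∫ z, q a z ∂μ = 1)
    (S : Set Z) (hS : MeasurableSet S)
    (d : ℝ) (hd0 : 0 < d) (hd1 : d < 1)
    (hπS : ∫ z in S, π z ∂μ = 1 - d)
    (hqS : ∀ᵐ a ∂ν, ∫ z in S, q a z ∂μ = 1 - d)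
    (hpS_pos : ∀ᵐ a ∂(ν.withDensity fun a => ENNReal.ofReal (pdata a)),
        0 < (1 / (1 - d)) * ∫ z in S, ℓ a z * π z ∂μ)
    (hpSc_pos : ∀ᵐ a ∂(ν.withDensity fun a => ENNReal.ofReal (pdata a)),
        0 < (1 / d) * ∫ z in Sᶜ, ℓ a z * π z ∂μ)
    (hKLS_fin : Integrable (fun a => pdata a *
        Real.log (pdata a / ((1 / (1 - d)) * ∫ z in S, ℓ a z * π z ∂μ))) ν)
    (hKLSc_fin : Integrable (fun a => pdata a *
        Real.log (pdata a / ((1 / d) * ∫ z in Sᶜ, ℓ a z * π z ∂μ))) ν) :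
    ∫ a, pdata a * Real.log
        (((∫ z in S, q a z ∂μ) *
            ((1 / ∫ z in S, q a z ∂μ) *
              ∫ z in S, (ℓ a z * π z / q a z) * q a z ∂μ) /
            ∫ z, (ℓ a z * π z / q a z) * q a z ∂μ) /
          ((∫ z in Sᶜ, q a z ∂μ) *
            ((1 / ∫ z in Sᶜ, q a z ∂μ) *
              ∫ z in Sᶜ, (ℓ a z * π z / q a z) * q a z ∂μ) /
            ∫ z, (ℓ a z * π z / q a z) * q a z ∂μ)) ∂ν
      = ((∫ a, pdata a *
              Real.log (pdata a / ((1 / d) * ∫ z in Sᶜ, ℓ a z * π z ∂μ)) ∂ν)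
          - ∫ a, pdata a *
              Real.log (pdata a / ((1 / (1 - d)) * ∫ z in S, ℓ a z * π z ∂μ)) ∂ν)
        + Real.log ((1 - d) / d) := by
  have hd1' : 0 < 1 - d := by linarith
  have hm : Measurable fun a => ENNReal.ofReal (pdata a) := hpdata_meas.ennreal_ofReal
  rw [ae_withDensity_iff hm] at hpS_pos hpSc_pos
  have hpi : Integrable pdata ν := by
    by_contra h
    rw [integral_undef h] at hpdata_int
    exact zero_ne_one hpdata_int
  have hconst : Integrable (fun a => pdata a * Real.log ((1 - d) / d)) ν := hpi.mul_const _
  have hc : ∫ a, pdata a * Real.log ((1 - d) / d) ∂ν = Real.log ((1 - d) / d) := by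
    rw [integral_mul_const, hpdata_int, one_mul]
  have hcancel : ∀ a z, (ℓ a z * π z / q a z) * q a z = ℓ a z * π z := fun a z =>
    div_mul_cancel₀ _ (hq_pos a z).ne'
  simp only [hcancel]
  rw [← integral_sub hKLSc_fin hKLS_fin]
  conv_rhs => rw [← hc]
  refine Eq.trans ?_ (integral_add (hKLSc_fin.sub hKLS_fin) hconst)
  apply integral_congr_ae
  filter_upwards [hqS, hpS_pos, hpSc_pos] with a hq1 h1 h2
  rcases (hpdata_nonneg a).eq_or_lt with h0 | h0
  · simp [← h0]
  have hne : ENNReal.ofReal (pdata a) ≠ 0 := by simpa using h0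
  have hx := h1 hne
  have hy := h2 hne
  have hx' : 0 < ∫ z in S, ℓ a z * π z ∂μ :=
    pos_of_mul_pos_right hx (by positivity)
  have hy' : 0 < ∫ z in Sᶜ, ℓ a z * π z ∂μ :=
    pos_of_mul_pos_right hy (by positivity)
  have hiS : IntegrableOn (fun z => ℓ a z * π z) S μ := by
    by_contra h
    rw [integral_undef h] at hx'
    exact lt_irrefl _ hx'
  have hiSc : IntegrableOn (fun z => ℓ a z * π z) Sᶜ μ := by
    by_contra h
    rw [integral_undef h] at hy'
    exact lt_irrefl _ hy'
  have hi : Integrable (fun z => ℓ a z * π z) μ := by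
    have := hiS.union hiSc
    rwa [Set.union_compl_self, integrableOn_univ] at this
  have hqi : Integrable (q a) μ := by
    by_contra h
    have := hq_int a
    rw [integral_undef h] at this
    exact zero_ne_one this
  have hq2 : ∫ z in Sᶜ, q a z ∂μ = d := by
    have := integral_add_compl hS hqi
    rw [hq1, hq_int a] at this
    linarith
  have hsum := integral_add_compl hS hi
  rw [hq1, hq2, ← hsum]
  generalize (∫ z in S, ℓ a z * π z ∂μ) = x at *
  generalize (∫ z in Sᶜ, ℓ a z * π z ∂μ) = y at *
  have e : ((1 - d) * (1 / (1 - d) * x) / (x + y)) / (d * (1 / d * y) / (x + y)) = x / y := by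
    have : x + y ≠ 0 := by positivity
    field_simp
  rw [e, Real.log_div hx'.ne' hy'.ne', Real.log_div h0.ne' hx.ne', Real.log_div h0.ne' hy.ne',
    Real.log_mul (by positivity) hx'.ne', Real.log_mul (by positivity) hy'.ne',
    Real.log_div hd1'.ne' hd0.ne', one_div, one_div, Real.log_inv, Real.log_inv]
  ring
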